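/- Let r ≥ 1 and let n₁,…,n_r be integers. Define ℛ = {i ∈ {1,…,r} : n_i + n_{i+1} + ⋯ + n_r ≠ 0 or n_i = 0}. Then card ℛ ≥ ⌈r/2⌉, the least integer not smaller than r/2. (In particular r ∈ ℛ always, and if i ∉ ℛ with i ≥ 2 then i−1 ∈ ℛ.) -/

import Mathlib

/-- A subset of `Fin r` which contains the last index and the predecessor of every index
outside it has at least half of the elements. -/
theorem Fin.half_le_card_of_pred_mem {r : ℕ} (S : Finset (Fin r))
    (hlast : ∀ i : Fin r, (i : ℕ) + 1 = r → i ∈ S)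
    (hpred : ∀ i j : Fin r, (j : ℕ) + 1 = i → i ∉ S → j ∈ S) :
    (r + 1) / 2 ≤ S.card := by
  have hlt : ∀ i : Fin r, i ∉ S → (i : ℕ) + 1 < r := fun i hi =>
    lt_of_le_of_ne i.isLt fun h => hi (hlast i h)
  have hle : Sᶜ.card ≤ S.card := by
    refine Finset.card_le_card_of_injOn
      (fun i => if h : (i : ℕ) + 1 < r then ⟨i + 1, h⟩ else i) ?_ ?_
    · intro i hi
      have hiS : i ∉ S := by simpa using hi
      simp only [hlt i hiS, dite_true, Finset.mem_coe]
      by_contra h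
      exact hiS (hpred _ i rfl h)
    · intro i hi j hj hij
      have hiS : i ∉ S := by simpa using hi
      have hjS : j ∉ S := by simpa using hj
      simpa [hlt i hiS, hlt j hjS, Fin.ext_iff] using hij
  have hcard := S.card_add_card_compl
  rw [Fintype.card_fin] at hcard
  omega

/-- Splitting the first term off a sum over a final segment. -/
theorem Finset.sum_filter_le_eq_add_sum_filter_lt {ι M : Type*} [Fintype ι] [LinearOrder ι]
    [AddCommMonoid M] (n : ι → M) (i : ι) :
    ∑ j ∈ Finset.univ.filter (fun j => i ≤ j), n j =
      n i + ∑ j ∈ Finset.univ.filter (fun j => i < j), n j := by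
  rw [← Finset.sum_insert (by simp)]
  congr 1
  ext j
  simp [le_iff_eq_or_lt, eq_comm]

/-- for integers n₁,…,n_r (r ≥ 1) and
ℛ = {i : n_i + ⋯ + n_r ≠ 0 or n_i = 0}, one has card ℛ ≥ ⌈r/2⌉; in particular the
last index belongs to ℛ, and if i ∉ ℛ is not the first index then its predecessor
belongs to ℛ. -/
theorem card_R_ge_ceil_half (r : ℕ) (hr : 1 ≤ r) (n : Fin r → ℤ) :
    (r + 1) / 2 ≤
      (Finset.univ.filter fun i : Fin r =>
        (∑ j ∈ Finset.univ.filter (fun j : Fin r => i ≤ j), n j) ≠ 0 ∨ n i = 0).card ∧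
    (⟨r - 1, by omega⟩ : Fin r) ∈
      (Finset.univ.filter fun i : Fin r =>
        (∑ j ∈ Finset.univ.filter (fun j : Fin r => i ≤ j), n j) ≠ 0 ∨ n i = 0) ∧
    ∀ i : Fin r,
      i ∉ (Finset.univ.filter fun i : Fin r =>
        (∑ j ∈ Finset.univ.filter (fun j : Fin r => i ≤ j), n j) ≠ 0 ∨ n i = 0) →
      0 < (i : ℕ) →
      (⟨(i : ℕ) - 1, by omega⟩ : Fin r) ∈
        (Finset.univ.filter fun i : Fin r =>
          (∑ j ∈ Finset.univ.filter (fun j : Fin r => i ≤ j), n j) ≠ 0 ∨ n i = 0) := by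
  have hlast : ∀ i : Fin r, (i : ℕ) + 1 = r →
      i ∈ (Finset.univ.filter fun i : Fin r =>
        (∑ j ∈ Finset.univ.filter (fun j : Fin r => i ≤ j), n j) ≠ 0 ∨ n i = 0) := by
    intro i hi
    have hempty : Finset.univ.filter (fun j : Fin r => i < j) = ∅ := by
      ext j
      simp only [Finset.mem_filter, Finset.mem_univ, true_and, Fin.lt_def,
        Finset.notMem_empty, iff_false]
      omega
    rw [Finset.mem_filter, Finset.sum_filter_le_eq_add_sum_filter_lt, hempty,
      Finset.sum_empty, add_zero]
    exact ⟨Finset.mem_univ _, ne_or_eq _ _⟩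
  have hpred : ∀ i k : Fin r, (k : ℕ) + 1 = i →
      i ∉ (Finset.univ.filter fun i : Fin r =>
        (∑ j ∈ Finset.univ.filter (fun j : Fin r => i ≤ j), n j) ≠ 0 ∨ n i = 0) →
      k ∈ (Finset.univ.filter fun i : Fin r =>
        (∑ j ∈ Finset.univ.filter (fun j : Fin r => i ≤ j), n j) ≠ 0 ∨ n i = 0) := by
    intro i k hk hi
    simp only [Finset.mem_filter, Finset.mem_univ, true_and, not_or, not_not] at hi
    have htail : Finset.univ.filter (fun j : Fin r => k < j) =
        Finset.univ.filter (fun j : Fin r => i ≤ j) := by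
      ext j
      simp only [Finset.mem_filter, Finset.mem_univ, true_and, Fin.lt_def, Fin.le_def]
      omega
    rw [Finset.mem_filter, Finset.sum_filter_le_eq_add_sum_filter_lt, htail, hi.1, add_zero]
    exact ⟨Finset.mem_univ _, ne_or_eq _ _⟩
  exact ⟨Fin.half_le_card_of_pred_mem _ hlast hpred, hlast _ (Nat.sub_add_cancel hr),
    fun i hi hpos => hpred i _ (Nat.sub_add_cancel hpos) hi⟩
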